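/- Let Y be a real random variable with a Lebesgue density, 𝔼Y = 0, 𝔼Y² = 1, and finite χ²-distance to the standard normal. If χ²(Y,𝒩) ≤ 0.96, then 𝔼 e^{tY} < e^{t²} for all real t ≠ 0. -/

import Mathlib

open MeasureTheory ProbabilityTheory Real

/-- Density of the standard normal distribution. -/
noncomputable def stdGaussianDensity (x : ℝ) : ℝ := Real.exp (-x^2/2) / Real.sqrt (2*Real.pi)

/-- χ² distance between (the law of) a random variable `X` (with Lebesgue density given by
`MeasureTheory.pdf`) and the standard normal distribution. -/
noncomputable def chiSqDist {Ω : Type*} [MeasureSpace Ω] (X : Ω → ℝ) : ℝ :=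
  ∫ x, ((MeasureTheory.pdf X ℙ volume x).toReal / stdGaussianDensity x - 1)^2
    * stdGaussianDensity x

/-- The χ² distance of `X` to the standard normal is finite (the defining integral converges). -/
def HasFiniteChiSq {Ω : Type*} [MeasureSpace Ω] (X : Ω → ℝ) : Prop :=
  MeasureTheory.Integrable (fun x =>
    ((MeasureTheory.pdf X ℙ volume x).toReal / stdGaussianDensity x - 1)^2
      * stdGaussianDensity x)

theorem exp_quadratic_pos (u : ℝ) (hu : 0 < u) :
    0.96 * (exp (2 * u) - 1 - 2 * u - 2 * u ^ 2) < (exp u - 1) ^ 2 := by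
  have hs (v : ℝ) : HasSum (fun k : ℕ => v ^ k / k.factorial) (exp v) := by
    rw [Real.exp_eq_exp_ℝ]
    exact NormedSpace.expSeries_div_hasSum_exp v
  have hsum := ((hs (2 * u)).mul_left 0.04).sub ((hs u).mul_left 2)
  have hle := sum_le_hasSum (Finset.range 14) (fun k hk => ?_) hsum
  · simp only [Finset.sum_range_succ, Finset.sum_range_zero, Nat.factorial] at hle
    have hbase : -2 ≤ u / 2.7 - 1 := by
      have : 0 < u / 2.7 := by positivity
      linarith
    have hp (m : ℕ) : u ^ 4 * (2.7 ^ m * (1 + m * (u / 2.7 - 1))) ≤ u ^ (m + 4) := by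
      have := one_add_mul_le_pow hbase m
      rw [pow_add, mul_comm (u ^ m)]
      gcongr
      calc _ ≤ (2.7 : ℝ) ^ m * (1 + (u / 2.7 - 1)) ^ m := by gcongr
        _ = u ^ m := by rw [← mul_pow]; congr 1; ring
    have h6 := hp 2
    have h7 := hp 3
    have h8 := hp 4
    have h9 := hp 5
    have h10 := hp 6
    have h11 := hp 7
    have h12 := hp 8
    have h13 := hp 9
    have hexp : exp (2 * u) = exp u ^ 2 := by rw [← exp_nat_mul]; norm_num
    rw [hexp] at hle ⊢
    norm_num [mul_pow] at hle h6 h7 h8 h9 h10 h11 h12 h13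
    have hu2 : 0 < u ^ 2 := by positivity
    have hcubic : 0 < 1 - 0.28 * u - 0.19176 * u ^ 2 + 0.06019 * u ^ 3 := by
      nlinarith [mul_nonneg hu.le (sq_nonneg (u - 2.7)), sq_nonneg (u - 2.7)]
    have hpos := mul_pos hu2 hcubic
    have h4 : 0 < u ^ 4 := by positivity
    have h5 : 0 < u ^ 5 := by positivity
    linarith
  · have hk' : 6 ≤ k := by simp at hk; omega
    have : (64 : ℝ) ≤ 2 ^ k := by
      calc (64 : ℝ) = 2 ^ 6 := by norm_num
        _ ≤ 2 ^ k := pow_le_pow_right₀ (by norm_num) hk'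
    have h2 : (0.04 * ((2 * u) ^ k / k.factorial) - 2 * (u ^ k / k.factorial) : ℝ)
        = (0.04 * 2 ^ k - 2) * (u ^ k / k.factorial) := by rw [mul_pow]; ring
    rw [h2]
    exact mul_nonneg (by linarith) (by positivity)


theorem integrable_pow_mul_exp_gaussianReal (n : ℕ) (t : ℝ) :
    Integrable (fun x => x ^ n * exp (t * x)) (gaussianReal 0 1) :=
  integrable_pow_mul_exp_of_mem_interior_integrableExpSet (X := id) (v := t) (by simp) n

theorem integral_pow_succ_mul_exp_gaussianReal {n : ℕ} {p : ℝ → ℝ} {p' : ℝ → ℝ}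
    (hp : ∀ t, HasDerivAt p (p' t) t)
    (h : ∀ t, ∫ x, x ^ n * exp (t * x) ∂gaussianReal 0 1 = p t * exp (t ^ 2 / 2)) (t : ℝ) :
    ∫ x, x ^ (n + 1) * exp (t * x) ∂gaussianReal 0 1 = (p' t + t * p t) * exp (t ^ 2 / 2) := by
  have h1 : HasDerivAt (fun t => ∫ x, x ^ n * exp (t * x) ∂gaussianReal 0 1)
      (∫ x, x ^ (n + 1) * exp (t * x) ∂gaussianReal 0 1) t :=
    hasDerivAt_integral_pow_mul_exp_real (X := id) (by simp) n
  rw [funext h] at h1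
  have h2 : HasDerivAt (fun t : ℝ => exp (t ^ 2 / 2)) (exp (t ^ 2 / 2) * t) t := by
    convert! ((hasDerivAt_pow 2 t).div_const 2).exp using 1
    simp
  rw [h1.unique ((hp t).mul h2)]
  ring

theorem integral_pow_mul_exp_gaussianReal (t : ℝ) :
    ∫ x, x ^ 0 * exp (t * x) ∂gaussianReal 0 1 = exp (t ^ 2 / 2) ∧
    ∫ x, x ^ 1 * exp (t * x) ∂gaussianReal 0 1 = t * exp (t ^ 2 / 2) ∧
    ∫ x, x ^ 2 * exp (t * x) ∂gaussianReal 0 1 = (1 + t ^ 2) * exp (t ^ 2 / 2) ∧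
    ∫ x, x ^ 3 * exp (t * x) ∂gaussianReal 0 1 = (3 * t + t ^ 3) * exp (t ^ 2 / 2) ∧
    ∫ x, x ^ 4 * exp (t * x) ∂gaussianReal 0 1 =
      (3 + 6 * t ^ 2 + t ^ 4) * exp (t ^ 2 / 2) := by
  have h0 (t : ℝ) : ∫ x, x ^ 0 * exp (t * x) ∂gaussianReal 0 1 = 1 * exp (t ^ 2 / 2) := by
    have := congrFun (mgf_id_gaussianReal (μ := 0) (v := 1)) t
    simpa [mgf] using this
  have h1 := integral_pow_succ_mul_exp_gaussianReal (fun t => hasDerivAt_const t 1) h0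
  have h2 := integral_pow_succ_mul_exp_gaussianReal (p' := fun _ => 1)
    (fun t => by simpa using hasDerivAt_id' t) h1
  have h3 := integral_pow_succ_mul_exp_gaussianReal (p' := fun t => 2 * t)
    (fun t => by
      convert! ((hasDerivAt_pow 2 t).const_add 1) using 1
      · ext; simp; ring
      · simp) h2
  have h4 := integral_pow_succ_mul_exp_gaussianReal (p' := fun t => 3 + 3 * t ^ 2)
    (fun t => by
      convert! ((hasDerivAt_id t).const_mul 3).add (hasDerivAt_pow 3 t) using 1
      · ext; simp; ring
      · simp) h3
  refine ⟨?_, ?_, ?_, ?_, ?_⟩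
  · rw [h0]; ring
  · rw [h1]; ring
  · rw [h2]; ring
  · rw [h3]; ring
  · rw [h4]; ring

/-- The remainder of `exp (t * x)` after its projection on the Hermite polynomials of degree at
most two in `L²` of the standard normal law. -/
noncomputable def expHermiteRemainder (t x : ℝ) : ℝ :=
  exp (t * x) - exp (t ^ 2 / 2) * (1 + t * x + t ^ 2 / 2 * (x ^ 2 - 1))

theorem integral_expHermiteRemainder_sq (t : ℝ) :
    Integrable (fun x => expHermiteRemainder t x ^ 2) (gaussianReal 0 1) ∧
    ∫ x, expHermiteRemainder t x ^ 2 ∂gaussianReal 0 1 =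
      exp (t ^ 2) * (exp (t ^ 2) - 1 - t ^ 2 - t ^ 4 / 2) := by
  have hi (n : ℕ) (s : ℝ) := integrable_pow_mul_exp_gaussianReal n s
  set E := exp (t ^ 2 / 2) with hE
  have hexp : (fun x => expHermiteRemainder t x ^ 2) = fun x =>
      x ^ 0 * exp ((2 * t) * x)
      + (-2 * E * (1 - t ^ 2 / 2)) * (x ^ 0 * exp (t * x))
      + (-2 * E * t) * (x ^ 1 * exp (t * x))
      + (-E * t ^ 2) * (x ^ 2 * exp (t * x))
      + (E ^ 2 * (1 - t ^ 2 / 2) ^ 2) * (x ^ 0 * exp (0 * x))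
      + (E ^ 2 * (2 * t * (1 - t ^ 2 / 2))) * (x ^ 1 * exp (0 * x))
      + (E ^ 2 * (t ^ 2 + t ^ 2 * (1 - t ^ 2 / 2))) * (x ^ 2 * exp (0 * x))
      + (E ^ 2 * t ^ 3) * (x ^ 3 * exp (0 * x))
      + (E ^ 2 * (t ^ 4 / 4)) * (x ^ 4 * exp (0 * x)) := by
    ext x
    have : exp (2 * t * x) = exp (t * x) ^ 2 := by rw [← exp_nat_mul]; congr 1; push_cast; ring
    rw [this, expHermiteRemainder, ← hE, zero_mul, exp_zero]
    ring
  rw [hexp]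
  refine ⟨by fun_prop, ?_⟩
  obtain ⟨a0, -⟩ := integral_pow_mul_exp_gaussianReal (2 * t)
  obtain ⟨b0, b1, b2, -⟩ := integral_pow_mul_exp_gaussianReal t
  obtain ⟨c0, c1, c2, c3, c4⟩ := integral_pow_mul_exp_gaussianReal 0
  iterate 8 rw [integral_add (by fun_prop) (by fun_prop)]
  simp only [integral_const_mul, a0, b0, b1, b2, c0, c1, c2, c3, c4]
  have hE2 : exp (t ^ 2) = E ^ 2 := by rw [hE, ← exp_nat_mul]; congr 1; push_cast; ring
  have hE4 : exp ((2 * t) ^ 2 / 2) = E ^ 4 := by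
    rw [hE, ← exp_nat_mul]; congr 1; push_cast; ring
  rw [hE2, hE4, ← hE]
  norm_num
  ring

theorem integral_mul_exp_lt {g : ℝ → ℝ} (hg : MemLp g 2 (gaussianReal 0 1))
    (hsq : ∫ x, g x ^ 2 ∂gaussianReal 0 1 ≤ 0.96)
    (h0 : ∫ x, g x ∂gaussianReal 0 1 = 0)
    (h1 : ∫ x, g x * x ∂gaussianReal 0 1 = 0)
    (h2 : ∫ x, g x * x ^ 2 ∂gaussianReal 0 1 = 0) {t : ℝ} (ht : t ≠ 0) :
    ∫ x, g x * exp (t * x) ∂gaussianReal 0 1 < exp (t ^ 2) - exp (t ^ 2 / 2) := by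
  have hpow (n : ℕ) : MemLp (fun x : ℝ => x ^ n) 2 (gaussianReal 0 1) := by
    rw [memLp_two_iff_integrable_sq (by fun_prop)]
    simpa [← pow_mul] using integrable_pow_mul_exp_gaussianReal (n * 2) 0
  have hgpow (n : ℕ) : Integrable (fun x => g x * x ^ n) (gaussianReal 0 1) :=
    hg.integrable_mul (hpow n)
  have hg0 : Integrable g (gaussianReal 0 1) := by simpa using hgpow 0
  have hg1 : Integrable (fun x => g x * x) (gaussianReal 0 1) := by simpa using hgpow 1
  have hg2 := hgpow 2
  obtain ⟨hri, hrsq⟩ := integral_expHermiteRemainder_sq t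
  have hr : MemLp (expHermiteRemainder t) 2 (gaussianReal 0 1) := by
    rw [memLp_two_iff_integrable_sq (by unfold expHermiteRemainder; fun_prop)]
    exact hri
  have hgr : Integrable (fun x => g x * expHermiteRemainder t x) (gaussianReal 0 1) :=
    hg.integrable_mul hr
  set E := exp (t ^ 2 / 2) with hE
  have hsplit : ∫ x, g x * exp (t * x) ∂gaussianReal 0 1 =
      ∫ x, g x * expHermiteRemainder t x ∂gaussianReal 0 1 := by
    have : (fun x => g x * exp (t * x)) = fun x => g x * expHermiteRemainder t x
        + (E * (1 - t ^ 2 / 2)) * g x + (E * t) * (g x * x)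
        + (E * (t ^ 2 / 2)) * (g x * x ^ 2) := by
      ext x
      rw [expHermiteRemainder]
      ring
    rw [this]
    iterate 3 rw [integral_add (by fun_prop) (by fun_prop)]
    simp [integral_const_mul, h0, h1, h2]
  have hE2 : exp (t ^ 2) = E ^ 2 := by rw [hE, ← exp_nat_mul]; congr 1; push_cast; ring
  have hE1 : 1 < E := by rw [hE]; exact one_lt_exp_iff.2 (by positivity)
  have hD : 0 < E ^ 2 - E := by nlinarith
  have hscalar := exp_quadratic_pos (t ^ 2 / 2) (by positivity)
  rw [show 2 * (t ^ 2 / 2) = t ^ 2 by ring, hE2, ← hE] at hscalar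
  rw [hE2] at hrsq ⊢
  rw [hsplit]
  have hR : 0.96 * ∫ x, expHermiteRemainder t x ^ 2 ∂gaussianReal 0 1 < (E ^ 2 - E) ^ 2 := by
    rw [hrsq]
    have := mul_lt_mul_of_pos_left hscalar (by positivity : 0 < E ^ 2)
    linear_combination this
  set D := E ^ 2 - E
  -- AM-GM with the weight `D / 0.96` replaces the Cauchy-Schwarz inequality.
  have hamgm : ∫ x, g x * expHermiteRemainder t x ∂gaussianReal 0 1 ≤
      ∫ x, (D / 1.92 * g x ^ 2 + 0.48 / D * expHermiteRemainder t x ^ 2) ∂gaussianReal 0 1 := by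
    have hgsq := hg.integrable_sq
    refine integral_mono hgr (by fun_prop) fun x => ?_
    have : D / 1.92 * g x ^ 2 + 0.48 / D * expHermiteRemainder t x ^ 2
        - g x * expHermiteRemainder t x =
        (D * g x - 0.96 * expHermiteRemainder t x) ^ 2 / (1.92 * D) := by
      field_simp
      ring
    have : 0 ≤ (D * g x - 0.96 * expHermiteRemainder t x) ^ 2 / (1.92 * D) := by positivity
    simp only
    linarith
  rw [integral_add (hg.integrable_sq.const_mul _) (hri.const_mul _), integral_const_mul,
    integral_const_mul] at hamgm
  have hfirst : D / 1.92 * ∫ x, g x ^ 2 ∂gaussianReal 0 1 ≤ D / 1.92 * 0.96 := by gcongr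
  have hsecond : 0.48 / D * ∫ x, expHermiteRemainder t x ^ 2 ∂gaussianReal 0 1 < D / 2 := by
    rw [div_mul_eq_mul_div, div_lt_iff₀ hD]
    linarith
  calc _ < D / 1.92 * 0.96 + D / 2 := hamgm.trans_lt (add_lt_add_of_le_of_lt hfirst hsecond)
    _ = D := by ring

theorem stdGaussianDensity_eq_gaussianPDFReal : stdGaussianDensity = gaussianPDFReal 0 1 := by
  ext x
  simp [stdGaussianDensity, gaussianPDFReal, div_eq_inv_mul]

theorem stdGaussianDensity_pos (x : ℝ) : 0 < stdGaussianDensity x := by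
  rw [stdGaussianDensity_eq_gaussianPDFReal]
  exact gaussianPDFReal_pos 0 1 x one_ne_zero

theorem integral_gaussianReal_eq_integral_mul_stdGaussianDensity (f : ℝ → ℝ) :
    ∫ x, f x ∂gaussianReal 0 1 = ∫ x, f x * stdGaussianDensity x := by
  rw [integral_gaussianReal_eq_integral_smul one_ne_zero, stdGaussianDensity_eq_gaussianPDFReal]
  simp [mul_comm]

theorem integrable_gaussianReal_iff_integrable_mul_stdGaussianDensity (f : ℝ → ℝ) :
    Integrable f (gaussianReal 0 1) ↔ Integrable (fun x => f x * stdGaussianDensity x) := by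
  rw [gaussianReal_of_var_ne_zero _ one_ne_zero,
    integrable_withDensity_iff (measurable_gaussianPDF 0 1)
      (Filter.Eventually.of_forall fun x => gaussianPDF_lt_top),
    stdGaussianDensity_eq_gaussianPDFReal]
  simp

theorem measurable_stdGaussianDensity : Measurable stdGaussianDensity := by
  rw [stdGaussianDensity_eq_gaussianPDFReal]
  exact measurable_gaussianPDFReal 0 1

/-- The density of the law of `Y` with respect to the standard normal law, minus one. -/
noncomputable def gaussianRelativeDensity {Ω : Type*} [MeasureSpace Ω] (Y : Ω → ℝ) (x : ℝ) : ℝ :=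
  (MeasureTheory.pdf Y ℙ volume x).toReal / stdGaussianDensity x - 1

section Transfer

variable {Ω : Type*} [MeasureSpace Ω] {Y : Ω → ℝ}

theorem gaussianRelativeDensity_add_one_mul (f : ℝ → ℝ) (x : ℝ) :
    ((gaussianRelativeDensity Y x + 1) * f x) * stdGaussianDensity x =
      (MeasureTheory.pdf Y ℙ volume x).toReal • f x := by
  have := (stdGaussianDensity_pos x).ne'
  rw [gaussianRelativeDensity, smul_eq_mul]
  field_simp
  ring

theorem memLp_gaussianRelativeDensity (hfin : HasFiniteChiSq Y) :
    MemLp (gaussianRelativeDensity Y) 2 (gaussianReal 0 1) := by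
  have hmeas : Measurable (gaussianRelativeDensity Y) :=
    ((measurable_pdf Y ℙ volume).ennreal_toReal.div measurable_stdGaussianDensity).sub_const 1
  rw [memLp_two_iff_integrable_sq hmeas.aestronglyMeasurable,
    integrable_gaussianReal_iff_integrable_mul_stdGaussianDensity]
  exact hfin

variable [IsProbabilityMeasure (ℙ : Measure Ω)] [HasPDF Y ℙ]

theorem integrable_comp_iff_integrable_gaussianReal {f : ℝ → ℝ} (hf : Measurable f) :
    Integrable (fun ω => f (Y ω)) ↔
      Integrable (fun x => (gaussianRelativeDensity Y x + 1) * f x) (gaussianReal 0 1) := by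
  rw [integrable_gaussianReal_iff_integrable_mul_stdGaussianDensity,
    funext (gaussianRelativeDensity_add_one_mul f)]
  exact (pdf.integrable_pdf_smul_iff hf.aestronglyMeasurable).symm

theorem integral_comp_eq_integral_gaussianReal {f : ℝ → ℝ} (hf : Measurable f) :
    ∫ ω, f (Y ω) = ∫ x, (gaussianRelativeDensity Y x + 1) * f x ∂gaussianReal 0 1 := by
  rw [integral_gaussianReal_eq_integral_mul_stdGaussianDensity,
    funext (gaussianRelativeDensity_add_one_mul f)]
  exact (pdf.integral_pdf_smul hf.aestronglyMeasurable).symm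

theorem integrable_comp_of_memLp (hfin : HasFiniteChiSq Y) {f : ℝ → ℝ} (hf : Measurable f)
    (hf2 : MemLp f 2 (gaussianReal 0 1)) : Integrable (fun ω => f (Y ω)) := by
  rw [integrable_comp_iff_integrable_gaussianReal hf]
  simp only [add_mul, one_mul]
  exact ((memLp_gaussianRelativeDensity hfin).integrable_mul hf2).add
    (hf2.integrable (by norm_num))

theorem integral_comp_eq_add (hfin : HasFiniteChiSq Y) {f : ℝ → ℝ} (hf : Measurable f)
    (hf2 : MemLp f 2 (gaussianReal 0 1)) :
    ∫ ω, f (Y ω) = ∫ x, gaussianRelativeDensity Y x * f x ∂gaussianReal 0 1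
      + ∫ x, f x ∂gaussianReal 0 1 := by
  rw [integral_comp_eq_integral_gaussianReal hf]
  simp only [add_mul, one_mul]
  exact integral_add ((memLp_gaussianRelativeDensity hfin).integrable_mul hf2)
    (hf2.integrable (by norm_num))

end Transfer

theorem stmt16 {Ω : Type} [MeasureSpace Ω] [IsProbabilityMeasure (ℙ : Measure Ω)]
    (Y : Ω → ℝ) (hpdf : HasPDF Y ℙ) (hfin : HasFiniteChiSq Y)
    (hmean : ∫ ω, Y ω = 0) (hvar : ∫ ω, (Y ω)^2 = 1)
    (hchi : chiSqDist Y ≤ 0.96) :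
    ∀ t : ℝ, t ≠ 0 →
      ∫⁻ ω, ENNReal.ofReal (Real.exp (t * Y ω)) < ENNReal.ofReal (Real.exp (t^2)) := by
  intro t ht
  have hpow_exp (n : ℕ) (s : ℝ) :
      MemLp (fun x : ℝ => x ^ n * exp (s * x)) 2 (gaussianReal 0 1) := by
    rw [memLp_two_iff_integrable_sq (by fun_prop)]
    convert! integrable_pow_mul_exp_gaussianReal (n * 2) (2 * s) using 2 with x
    rw [mul_pow, ← pow_mul, ← exp_nat_mul]
    push_cast
    ring_nf
  have hexp : MemLp (fun x : ℝ => exp (t * x)) 2 (gaussianReal 0 1) := by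
    simpa using hpow_exp 0 t
  have heq (n : ℕ) := integral_comp_eq_add hfin (f := fun x => x ^ n) (by fun_prop)
    (by simpa using hpow_exp n 0)
  obtain ⟨-, -, m2, -⟩ := integral_pow_mul_exp_gaussianReal 0
  have e0 := heq 0
  have e1 := heq 1
  have e2 := heq 2
  norm_num at m2
  simp [m2, hmean, hvar] at e0 e1 e2
  have hsq : ∫ x, gaussianRelativeDensity Y x ^ 2 ∂gaussianReal 0 1 ≤ 0.96 := by
    rw [integral_gaussianReal_eq_integral_mul_stdGaussianDensity]
    exact hchi
  have hlt := integral_mul_exp_lt (memLp_gaussianRelativeDensity hfin) hsq e0 e1.symm e2 ht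
  have hint := integrable_comp_of_memLp hfin (by fun_prop) hexp
  rw [← ofReal_integral_eq_lintegral_ofReal hint
    (Filter.Eventually.of_forall fun ω => (exp_pos _).le),
    ENNReal.ofReal_lt_ofReal_iff (exp_pos _), integral_comp_eq_add hfin (by fun_prop) hexp]
  have h0 := (integral_pow_mul_exp_gaussianReal t).1
  simp only [pow_zero, one_mul] at h0
  rw [h0]
  linarith
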